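/- Let ℓ ≥ 2 and let 1 ≤ i ≤ ℓ, 1 ≤ j ≤ ℓ. If φ_j(x_i) is nonzero, then in(φ_j(x_i)) ≤ x_1²·x_2²⋯x_{i−1}²·x_i^{2ℓ−2i} in the pure lexicographic order. -/

import Mathlib

open MvPolynomial Finset

noncomputable section

/-- Elementary symmetric function of degree `n` of the values of `f` on the finite set `s`. -/
def esymVal {α R : Type*} [CommSemiring R] (s : Finset α) (f : α → R) (n : ℕ) : R :=
  ∑ t ∈ Finset.powersetCard n s, ∏ a ∈ t, f a

/-- The characterizing conditions for the family of Bernoulli-like polynomials `B p q`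
(for `p ≥ -1`, `q ≥ 0`, `(p,q) ≠ (-1,0)`):  oddness and the (denominator-cleared)
difference equations. -/
def BProp (B : ℤ → ℕ → Polynomial ℝ) : Prop :=
  (∀ (p : ℤ) (q : ℕ), -1 ≤ p → ¬(p = -1 ∧ q = 0) →
      (B p q).comp (-Polynomial.X) = -(B p q)) ∧
  (∀ (p q : ℕ),
      (2 * Polynomial.X + 1) * ((B p q).comp (Polynomial.X + 1) - B p q)
        = ((Polynomial.X + 1) ^ p - (-Polynomial.X) ^ p)
            * (Polynomial.X + 1) ^ q * (-Polynomial.X) ^ q) ∧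
  (∀ q : ℕ, 1 ≤ q →
      (B (-1) q).comp (Polynomial.X + 1) - B (-1) q
        = -((-Polynomial.X) * (Polynomial.X + 1)) ^ (q - 1))

/-- The polynomial ring `S = ℝ[x_1, …, x_ℓ, z]`; the variable indexed by
`Fin.castSucc i` is `x_{i+1}` and the variable indexed by `Fin.last ℓ` is `z`. -/
abbrev SS (ℓ : ℕ) := MvPolynomial (Fin (ℓ + 1)) ℝ

/-- The field of rational functions, in which the defining formulas for the `φ_j` live. -/
abbrev KK (ℓ : ℕ) := FractionRing (SS ℓ)

/-- `x_{i+1}` as a rational function. -/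
def xx (ℓ : ℕ) (i : Fin ℓ) : KK ℓ := algebraMap (SS ℓ) (KK ℓ) (X i.castSucc)

/-- `z` as a rational function. -/
def zz (ℓ : ℕ) : KK ℓ := algebraMap (SS ℓ) (KK ℓ) (X (Fin.last ℓ))

/-- `ar B_{p,q}(x, z) = z^{p+2q}·B_{p,q}(x/z)`, as a rational function; by convention
`ar B_{-1,0}(x,z) = -1/x`. -/
def arB (B : ℤ → ℕ → Polynomial ℝ) (ℓ : ℕ) (p : ℤ) (q : ℕ) (x : KK ℓ) : KK ℓ :=
  if p = -1 ∧ q = 0 then -x⁻¹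
  else zz ℓ ^ (p + 2 * (q : ℤ)) *
    Polynomial.eval₂ ((algebraMap (SS ℓ) (KK ℓ)).comp (MvPolynomial.C)) (x / zz ℓ) (B p q)

/-- `J = {x_1, …, x_{j-1}}` (as a set of indices). -/
def Jset (ℓ : ℕ) (j : Fin ℓ) : Finset (Fin ℓ) := univ.filter (· < j)

/-- The value `φ_j(x_i)` (an element of the fraction field, which is in fact
a polynomial).  Here `j` with `(j:ℕ)+1 < ℓ` encodes `φ_{j+1}`, `1 ≤ j+1 ≤ ℓ-1`,
and `j = Fin.last` encodes `φ_ℓ`. -/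
def phi (B : ℤ → ℕ → Polynomial ℝ) (ℓ : ℕ) (j i : Fin ℓ) : KK ℓ :=
  if h : (j : ℕ) + 1 < ℓ then
    (xx ℓ j - xx ℓ ⟨(j : ℕ) + 1, h⟩ - zz ℓ) *
      ∑ K1 ∈ (Jset ℓ j).powerset, ∑ K2 ∈ ((Jset ℓ j) \ K1).powerset,
        (∏ a ∈ K1, xx ℓ a) * (∏ a ∈ K2, xx ℓ a) ^ 2 * (-zz ℓ) ^ K1.card *
          ∑ n1 ∈ Finset.range 3, ∑ n2 ∈ Finset.range (ℓ - (j : ℕ) - 1),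
            (-1 : KK ℓ) ^ (n1 + n2) *
              esymVal ({j, ⟨(j : ℕ) + 1, h⟩} : Finset (Fin ℓ)) (xx ℓ) n1 *
              esymVal (univ.filter (fun a : Fin ℓ => (j : ℕ) + 1 < (a : ℕ)))
                (fun a => xx ℓ a ^ 2) n2 *
              arB B ℓ ((2 - (n1 : ℤ)) + 2 * ((ℓ : ℤ) - (j : ℤ) - 2 - (n2 : ℤ)) - 1)
                ((j : ℕ) - K1.card - K2.card) (xx ℓ i)
  else
    ∑ K1 ∈ (Jset ℓ j).powerset, ∑ K2 ∈ ((Jset ℓ j) \ K1).powerset,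
      (∏ a ∈ K1, xx ℓ a) * (∏ a ∈ K2, xx ℓ a) ^ 2 * (-zz ℓ) ^ K1.card * (-(xx ℓ j)) *
        arB B ℓ (-1) ((j : ℕ) - K1.card - K2.card) (xx ℓ i)


/-- The exponent vector of the monomial `x_1²·x_2²⋯x_{i−1}²·x_i^{2ℓ−2i}`
(with the `1`-based index `i` corresponding to `i : Fin ℓ` via `i ↦ (i:ℕ)+1`). -/
def expo (ℓ : ℕ) (i : Fin ℓ) : Fin (ℓ + 1) →₀ ℕ :=
  Finsupp.equivFunOnFinite.symm fun p =>
    if (p : ℕ) < (i : ℕ) then 2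
    else if (p : ℕ) = (i : ℕ) then 2 * (ℓ - 1 - (i : ℕ)) else 0

/-- After clearing a denominator `z^N·x_i^M`, the rational function `f` becomes a homogeneous
polynomial, making `f` homogeneous of degree `D`, whose degree in each variable `x_a` with
`a ≠ i` is at most `m a`. -/
def HomogDegLE {ℓ : ℕ} (i : Fin ℓ) (D : ℤ) (m : Fin ℓ → ℕ) (f : KK ℓ) : Prop :=
  ∃ (N M n : ℕ) (Q : SS ℓ), zz ℓ ^ N * xx ℓ i ^ M * f = algebraMap (SS ℓ) (KK ℓ) Q ∧
    Q.IsHomogeneous n ∧ (n : ℤ) = N + M + D ∧ ∀ a, a ≠ i → Q.degreeOf a.castSucc ≤ m a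

lemma zz_ne_zero (ℓ : ℕ) : zz ℓ ≠ 0 := by
  simp [zz]

lemma xx_ne_zero {ℓ : ℕ} (i : Fin ℓ) : xx ℓ i ≠ 0 := by
  simp [xx]

lemma isHomogeneous_denom_mul {ℓ : ℕ} (i : Fin ℓ) (N M : ℕ) {n : ℕ} {Q : SS ℓ}
    (hQ : Q.IsHomogeneous n) :
    (X (Fin.last ℓ) ^ N * X i.castSucc ^ M * Q).IsHomogeneous (N + M + n) :=
  (((isHomogeneous_X_pow _ _).mul (isHomogeneous_X_pow _ _)).mul hQ)

lemma degreeOf_denom_mul_le {ℓ : ℕ} {i a : Fin ℓ} (ha : a ≠ i) (N M : ℕ) (Q : SS ℓ) :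
    (X (Fin.last ℓ) ^ N * X i.castSucc ^ M * Q).degreeOf a.castSucc ≤
      Q.degreeOf a.castSucc := by
  have h1 : a.castSucc ≠ Fin.last ℓ := (Fin.castSucc_lt_last a).ne
  have h2 : a.castSucc ≠ i.castSucc := fun h => ha (Fin.castSucc_injective _ h)
  have h3 := degreeOf_mul_le a.castSucc (X (Fin.last ℓ) ^ N * X i.castSucc ^ M) Q
  have h4 := degreeOf_mul_le a.castSucc (X (Fin.last ℓ) ^ N : SS ℓ) (X i.castSucc ^ M)
  rw [degreeOf_X_pow_of_ne N h1, degreeOf_X_pow_of_ne M h2] at h4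
  lia

namespace HomogDegLE

variable {ℓ : ℕ} {i : Fin ℓ} {D E : ℤ} {m k : Fin ℓ → ℕ} {f g : KK ℓ}

lemma mono (hf : HomogDegLE i D m f) (h : ∀ a, a ≠ i → m a ≤ k a) : HomogDegLE i D k f := by
  obtain ⟨N, M, n, Q, h1, h2, h3, h4⟩ := hf
  exact ⟨N, M, n, Q, h1, h2, h3, fun a ha => (h4 a ha).trans (h a ha)⟩

lemma of_algebraMap {Q : SS ℓ} {n : ℕ} (hQ : Q.IsHomogeneous n)
    (h : ∀ a, a ≠ i → Q.degreeOf a.castSucc ≤ m a) :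
    HomogDegLE i n m (algebraMap (SS ℓ) (KK ℓ) Q) :=
  ⟨0, 0, n, Q, by simp, hQ, by simp, h⟩

lemma mul (hf : HomogDegLE i D m f) (hg : HomogDegLE i E k g) :
    HomogDegLE i (D + E) (fun a => m a + k a) (f * g) := by
  obtain ⟨N, M, n, Q, h1, h2, h3, h4⟩ := hf
  obtain ⟨N', M', n', Q', h1', h2', h3', h4'⟩ := hg
  refine ⟨N + N', M + M', n + n', Q * Q', ?_, h2.mul h2', by push_cast; lia, fun a ha => ?_⟩
  · rw [map_mul, ← h1, ← h1']; ring
  · exact (degreeOf_mul_le _ _ _).trans (add_le_add (h4 a ha) (h4' a ha))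

lemma add (hf : HomogDegLE i D m f) (hg : HomogDegLE i D m g) :
    HomogDegLE i D m (f + g) := by
  obtain ⟨N, M, n, Q, h1, h2, h3, h4⟩ := hf
  obtain ⟨N', M', n', Q', h1', h2', h3', h4'⟩ := hg
  have hn : N + M + n' = N' + M' + n := by lia
  refine ⟨N + N', M + M', N' + M' + n,
    X (Fin.last ℓ) ^ N' * X i.castSucc ^ M' * Q + X (Fin.last ℓ) ^ N * X i.castSucc ^ M * Q',
    ?_, ?_, by push_cast; lia, fun a ha => ?_⟩
  · simp only [map_add, map_mul, map_pow, ← h1, ← h1']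
    simp only [zz, xx]
    ring
  · exact (isHomogeneous_denom_mul i N' M' h2).add (hn ▸ isHomogeneous_denom_mul i N M h2')
  · exact (degreeOf_add_le _ _ _).trans (max_le
      ((degreeOf_denom_mul_le ha _ _ _).trans (h4 a ha))
      ((degreeOf_denom_mul_le ha _ _ _).trans (h4' a ha)))

lemma const (c : ℝ) :
    HomogDegLE i 0 (fun _ => 0) ((algebraMap (SS ℓ) (KK ℓ)).comp MvPolynomial.C c) :=
  of_algebraMap (isHomogeneous_C _ c) (by simp)

lemma one : HomogDegLE i 0 (fun _ => 0) (1 : KK ℓ) := by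
  simpa using const (i := i) 1

lemma neg_one : HomogDegLE i 0 (fun _ => 0) (-1 : KK ℓ) := by
  simpa using const (i := i) (-1)

lemma neg (hf : HomogDegLE i D m f) : HomogDegLE i D m (-f) := by
  simpa using neg_one.mul hf

lemma sub (hf : HomogDegLE i D m f) (hg : HomogDegLE i D m g) :
    HomogDegLE i D m (f - g) :=
  sub_eq_add_neg f g ▸ hf.add hg.neg

lemma pow (hf : HomogDegLE i D m f) (n : ℕ) :
    HomogDegLE i (n * D) (fun a => n * m a) (f ^ n) := by
  induction n with
  | zero => simpa using one
  | succ n ih =>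
    rw [pow_succ]
    convert ih.mul hf using 1
    · push_cast; ring
    · ext a; ring

/-- The zero function is homogeneous of every degree. -/
lemma zero : HomogDegLE i D m (0 : KK ℓ) :=
  ⟨D.natAbs, 0, (D.natAbs + D).toNat, 0, by simp, isHomogeneous_zero _ _ _, by lia, by simp⟩

lemma sum {α : Type*} (s : Finset α) {F : α → KK ℓ} (h : ∀ t ∈ s, HomogDegLE i D m (F t)) :
    HomogDegLE i D m (∑ t ∈ s, F t) :=
  Finset.sum_induction F (HomogDegLE i D m) (fun _ _ => add) zero h

lemma var_self : HomogDegLE i 1 (fun _ => 0) (xx ℓ i) :=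
  of_algebraMap (isHomogeneous_X _ _) fun _ ha =>
    (degreeOf_X_of_ne fun h => ha (Fin.castSucc_injective _ h)).le

lemma var (b : Fin ℓ) : HomogDegLE i 1 (fun a => if a = b then 1 else 0) (xx ℓ b) :=
  of_algebraMap (isHomogeneous_X _ _) fun _ _ => by
    simp [degreeOf_X]

lemma zvar : HomogDegLE i 1 (fun _ => 0) (zz ℓ) :=
  of_algebraMap (isHomogeneous_X _ _) fun a _ =>
    (degreeOf_X_of_ne (Fin.castSucc_lt_last a).ne).le

lemma zvar_inv : HomogDegLE i (-1) (fun _ => 0) (zz ℓ)⁻¹ :=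
  ⟨1, 0, 0, 1, by simp [zz_ne_zero], isHomogeneous_one _ _, by simp, by simp⟩

lemma var_self_inv : HomogDegLE i (-1) (fun _ => 0) (xx ℓ i)⁻¹ :=
  ⟨0, 1, 0, 1, by simp [xx_ne_zero], isHomogeneous_one _ _, by simp, by simp⟩

lemma zvar_zpow (n : ℤ) : HomogDegLE i n (fun _ => 0) (zz ℓ ^ n) := by
  obtain ⟨n, rfl | rfl⟩ := n.eq_nat_or_neg
  · simpa using (zvar (i := i)).pow n
  · simpa using (zvar_inv (i := i)).pow n

lemma eval₂_div (p : Polynomial ℝ) :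
    HomogDegLE i 0 (fun _ => 0)
      (p.eval₂ ((algebraMap (SS ℓ) (KK ℓ)).comp MvPolynomial.C) (xx ℓ i / zz ℓ)) := by
  rw [Polynomial.eval₂_eq_sum_range]
  refine sum _ fun n _ => ?_
  have h : HomogDegLE i 0 (fun _ => 0) (xx ℓ i / zz ℓ) := by
    simpa [div_eq_mul_inv] using var_self.mul (zvar_inv (i := i))
  simpa using (const (i := i) (p.coeff n)).mul (h.pow n)

lemma arB_self (B : ℤ → ℕ → Polynomial ℝ) (p : ℤ) (q : ℕ) :
    HomogDegLE i (p + 2 * q) (fun _ => 0) (arB B ℓ p q (xx ℓ i)) := by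
  unfold arB
  split_ifs with h
  · simpa [h.1, h.2] using (var_self_inv (i := i)).neg
  · simpa using (zvar_zpow (i := i) (p + 2 * q)).mul (eval₂_div (B p q))

lemma prod_var (s : Finset (Fin ℓ)) :
    HomogDegLE i #s (fun a => if a ∈ s then 1 else 0) (∏ a ∈ s, xx ℓ a) := by
  induction s using Finset.induction_on with
  | empty => simpa using one
  | insert b s hb ih =>
    rw [Finset.prod_insert hb, Finset.card_insert_of_notMem hb]
    convert ((var b).mul ih).mono (k := fun a => if a ∈ insert b s then 1 else 0) ?_ using 1
    · push_cast; ring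
    · intro a _
      by_cases hab : a = b
      · simp [hab, hb]
      · simp [hab]

lemma esymVal_pow (s : Finset (Fin ℓ)) (e n : ℕ) :
    HomogDegLE i (e * n) (fun a => e * if a ∈ s then 1 else 0)
      (esymVal s (fun a => xx ℓ a ^ e) n) := by
  refine sum _ fun t ht => ?_
  obtain ⟨hts, rfl⟩ := Finset.mem_powersetCard.1 ht
  rw [Finset.prod_pow]
  refine ((prod_var t).pow e).mono fun a _ => Nat.mul_le_mul_left e ?_
  by_cases hat : a ∈ t
  · simp [hat, hts hat]
  · simp [hat]

lemma subset_monomial (K1 K2 : Finset (Fin ℓ)) :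
    HomogDegLE i (2 * #K1 + 2 * #K2)
      (fun a => (if a ∈ K1 then 1 else 0) + 2 * if a ∈ K2 then 1 else 0)
      ((∏ a ∈ K1, xx ℓ a) * (∏ a ∈ K2, xx ℓ a) ^ 2 * (-zz ℓ) ^ #K1) := by
  convert! ((prod_var K1).mul ((prod_var K2).pow 2)).mul ((zvar (i := i)).neg.pow #K1) using 1
  push_cast; ring

lemma bounds_of_algebraMap {P : SS ℓ} (hP : HomogDegLE i D m (algebraMap (SS ℓ) (KK ℓ) P))
    {d : Fin (ℓ + 1) →₀ ℕ} (hd : d ∈ P.support) :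
    (d.degree : ℤ) = D ∧ ∀ a, a ≠ i → d a.castSucc ≤ m a := by
  obtain ⟨N, M, n, Q, h1, h2, h3, h4⟩ := hP
  set e : Fin (ℓ + 1) →₀ ℕ := Finsupp.single (Fin.last ℓ) N + Finsupp.single i.castSucc M with he
  have hQ : Q = monomial e 1 * P := by
    apply IsFractionRing.injective (SS ℓ) (KK ℓ)
    rw [← h1, map_mul, he, ← mul_one (1 : ℝ), ← monomial_mul, ← X_pow_eq_monomial,
      ← X_pow_eq_monomial]
    simp [zz, xx]
  have hc : e + d ∈ Q.support := by
    rw [mem_support_iff, hQ, coeff_monomial_mul, one_mul]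
    exact mem_support_iff.1 hd
  constructor
  · have h := h2 (mem_support_iff.1 hc)
    rw [Pi.one_def, ← Finsupp.degree_eq_weight_one] at h
    simp only [he, map_add, Finsupp.degree_single] at h
    lia
  · intro a ha
    have h := (monomial_le_degreeOf a.castSucc hc).trans (h4 a ha)
    rw [Finsupp.add_apply] at h
    lia

end HomogDegLE

lemma card_le_of_subset_Jset {ℓ : ℕ} {j : Fin ℓ} {K1 K2 : Finset (Fin ℓ)}
    (h1 : K1 ∈ (Jset ℓ j).powerset) (h2 : K2 ∈ (Jset ℓ j \ K1).powerset) :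
    #K1 + #K2 ≤ j := by
  rw [Finset.mem_powerset] at h1 h2
  have hJ : #(Jset ℓ j) = j := by simp [Jset, Finset.filter_gt_eq_Iio]
  have h := Finset.card_le_card h2
  rw [Finset.card_sdiff_of_subset h1] at h
  have := Finset.card_le_card h1
  lia

lemma subset_exponent_le {ℓ : ℕ} {j : Fin ℓ} {K1 K2 : Finset (Fin ℓ)}
    (h1 : K1 ∈ (Jset ℓ j).powerset) (h2 : K2 ∈ (Jset ℓ j \ K1).powerset) (a : Fin ℓ) :
    ((if a ∈ K1 then 1 else 0) + 2 * if a ∈ K2 then 1 else 0) ≤ if a < j then 2 else 0 := by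
  rw [Finset.mem_powerset] at h1 h2
  by_cases ha1 : a ∈ K1
  · have hj : a < j := by simpa [Jset] using h1 ha1
    have ha2 : a ∉ K2 := fun h => (Finset.mem_sdiff.1 (h2 h)).2 ha1
    simp [ha1, ha2, hj]
  · by_cases ha2 : a ∈ K2
    · have hj : a < j := by simpa [Jset] using (Finset.mem_sdiff.1 (h2 ha2)).1
      simp [ha1, ha2, hj]
    · simp [ha1, ha2]

/-- `φ_j(x_i)` is homogeneous of degree `2ℓ - 2`, and of degree at most two in each variable
`x_a` with `a ≠ i`. -/
lemma homogDegLE_phi (B : ℤ → ℕ → Polynomial ℝ) (ℓ : ℕ) (j i : Fin ℓ) :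
    HomogDegLE i (2 * ℓ - 2) (fun _ => 2) (phi B ℓ j i) := by
  unfold phi
  split_ifs with h
  · set j' : Fin ℓ := ⟨(j : ℕ) + 1, h⟩ with hj'
    have hlin : HomogDegLE i 1 (fun a => if a ∈ ({j, j'} : Finset (Fin ℓ)) then 1 else 0)
        (xx ℓ j - xx ℓ j' - zz ℓ) := by
      refine (((HomogDegLE.var j).mono ?_).sub ((HomogDegLE.var j').mono ?_)).sub
        (HomogDegLE.zvar.mono ?_)
      · intro a _; by_cases ha : a = j <;> simp [ha]
      · intro a _; by_cases ha : a = j' <;> simp [ha]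
      · simp
    have hsum : HomogDegLE i (2 * ℓ - 3)
        (fun a => (if a < j then 2 else 0) + (if a ∈ ({j, j'} : Finset (Fin ℓ)) then 1 else 0) +
          2 * if a ∈ univ.filter (fun a : Fin ℓ => (j : ℕ) + 1 < (a : ℕ)) then 1 else 0)
        (∑ K1 ∈ (Jset ℓ j).powerset, ∑ K2 ∈ ((Jset ℓ j) \ K1).powerset,
        (∏ a ∈ K1, xx ℓ a) * (∏ a ∈ K2, xx ℓ a) ^ 2 * (-zz ℓ) ^ K1.card *
          ∑ n1 ∈ Finset.range 3, ∑ n2 ∈ Finset.range (ℓ - (j : ℕ) - 1),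
            (-1 : KK ℓ) ^ (n1 + n2) *
              esymVal ({j, j'} : Finset (Fin ℓ)) (xx ℓ) n1 *
              esymVal (univ.filter (fun a : Fin ℓ => (j : ℕ) + 1 < (a : ℕ)))
                (fun a => xx ℓ a ^ 2) n2 *
              arB B ℓ ((2 - (n1 : ℤ)) + 2 * ((ℓ : ℤ) - (j : ℤ) - 2 - (n2 : ℤ)) - 1)
                ((j : ℕ) - K1.card - K2.card) (xx ℓ i)) := by
      refine .sum _ fun K1 h1 => .sum _ fun K2 h2 => ?_
      simp_rw [Finset.mul_sum]
      refine .sum _ fun n1 _ => .sum _ fun n2 _ => ?_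
      have hK := card_le_of_subset_Jset h1 h2
      have hσ1 := HomogDegLE.esymVal_pow (i := i) {j, j'} 1 n1
      simp only [pow_one] at hσ1
      have hσ2 := HomogDegLE.esymVal_pow (i := i)
        (univ.filter (fun a : Fin ℓ => (j : ℕ) + 1 < (a : ℕ))) 2 n2
      have hB := HomogDegLE.arB_self (i := i) B
        ((2 - (n1 : ℤ)) + 2 * ((ℓ : ℤ) - (j : ℤ) - 2 - (n2 : ℤ)) - 1) ((j : ℕ) - #K1 - #K2)
      convert! ((HomogDegLE.subset_monomial K1 K2).mul
        ((((HomogDegLE.neg_one.pow (n1 + n2)).mul hσ1).mul hσ2).mul hB)).mono ?_ using 1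
      · push_cast [Nat.cast_sub (show #K1 ≤ j by lia), Nat.cast_sub (show #K2 ≤ j - #K1 by lia)]
        ring
      · intro a _
        have := subset_exponent_le h1 h2 a
        simp only [mul_zero, zero_add, add_zero, one_mul]
        lia
    convert! (hlin.mul hsum).mono ?_ using 1
    · ring
    · intro a _
      simp only [Finset.mem_insert, Finset.mem_singleton, Finset.mem_filter, Finset.mem_univ,
        true_and, Fin.ext_iff, Fin.lt_def, hj']
      split_ifs <;> lia
  · refine .sum _ fun K1 h1 => .sum _ fun K2 h2 => ?_
    have hK := card_le_of_subset_Jset h1 h2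
    have hj := j.isLt
    convert! (((HomogDegLE.subset_monomial K1 K2).mul (HomogDegLE.var j).neg).mul
      (HomogDegLE.arB_self B (-1) ((j : ℕ) - #K1 - #K2))).mono ?_ using 1
    · push_cast [Nat.cast_sub (show #K1 ≤ j by lia), Nat.cast_sub (show #K2 ≤ j - #K1 by lia)]
      lia
    · intro a _
      have := subset_exponent_le h1 h2 a
      simp only [add_zero]
      by_cases ha : a = j
      · simp_all
      · simp only [ha, if_false]
        split_ifs at this ⊢ <;> lia

lemma degree_expo {ℓ : ℕ} (i : Fin ℓ) : (expo ℓ i).degree = 2 * (ℓ - 1) := by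
  have hi := i.isLt
  have hsplit : ∀ p : Fin (ℓ + 1), expo ℓ i p = (if p < i.castSucc then 2 else 0) +
      if p = i.castSucc then 2 * (ℓ - 1 - (i : ℕ)) else 0 := by
    intro p
    simp only [expo, Finsupp.equivFunOnFinite_symm_apply_apply, Fin.lt_def, Fin.ext_iff,
      Fin.val_castSucc]
    split_ifs <;> lia
  simp only [Finsupp.degree_eq_sum, hsplit, Finset.sum_add_distrib, Finset.sum_ite_eq',
    Finset.mem_univ, if_true, ← Finset.sum_filter, Finset.filter_gt_eq_Iio, Finset.sum_const,
    Fin.card_Iio, Fin.val_castSucc, smul_eq_mul]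
  lia

lemma toLex_le_expo {ℓ : ℕ} (i : Fin ℓ) {d : Fin (ℓ + 1) →₀ ℕ}
    (hdeg : d.degree = 2 * (ℓ - 1)) (hle : ∀ a : Fin ℓ, a < i → d a.castSucc ≤ 2) :
    toLex d ≤ toLex (expo ℓ i) := by
  by_contra! hlt
  obtain ⟨p, heq, hp⟩ := Finsupp.Lex.lt_iff.1 hlt
  simp only [ofLex_toLex] at heq hp
  have hip : (i : ℕ) ≤ p := by
    by_contra! hpi
    have h := hle ⟨p, by lia⟩ hpi
    simp [expo, hpi] at hp
    exact absurd h (not_le.2 hp)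
  have hsum : (expo ℓ i).degree < d.degree := by
    rw [Finsupp.degree_eq_sum, Finsupp.degree_eq_sum]
    refine Finset.sum_lt_sum (fun q _ => ?_) ⟨p, Finset.mem_univ _, hp⟩
    rcases lt_trichotomy q p with hq | rfl | hq
    · exact (heq q hq).le
    · exact hp.le
    · have hiq : (i : ℕ) < q := hip.trans_lt hq
      simp [expo, hiq.ne', hiq.not_gt]
  rw [degree_expo] at hsum
  lia

/-- Let `ℓ ≥ 2` and let `1 ≤ i ≤ ℓ`, `1 ≤ j ≤ ℓ`.  If `φ_j(x_i)` is nonzero, then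
`in(φ_j(x_i)) ≤ x_1²·x_2²⋯x_{i−1}²·x_i^{2ℓ−2i}` in the pure lexicographic order
(`x_1 > x_2 > ⋯ > x_ℓ > z`): every monomial of `φ_j(x_i)` is lexicographically at
most this one. -/
theorem initial_phi_le (B : ℤ → ℕ → Polynomial ℝ) (hB : BProp B)
    (ℓ : ℕ) (hℓ : 2 ≤ ℓ) (i j : Fin ℓ) (h0 : phi B ℓ j i ≠ 0) :
    ∀ P : SS ℓ, algebraMap (SS ℓ) (KK ℓ) P = phi B ℓ j i →
      ∀ d ∈ P.support, toLex d ≤ toLex (expo ℓ i) := by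
  intro P hP d hd
  obtain ⟨hdeg, hle⟩ := (hP ▸ homogDegLE_phi B ℓ j i).bounds_of_algebraMap hd
  exact toLex_le_expo i (by lia) fun a ha => hle a ha.ne

end
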